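/- Exact recursion relating the Fourier coefficients for n and n−1 points: let γ : ℕ → ℝ be any sequence and for each m ≥ 1 let z^{(m)} denote the discrete Fourier transform of the first m values of γ. Then for every n ≥ 2 and every k with 0 ≤ k ≤ n−1, n · z^{(n)}_k = ∑_{l=0}^{n-2} z^{(n−1)}_l · ( ∑_{j=0}^{n-2} ξ_{k,l}^j ) + γ_{n−1} · exp(2πi·(n−1)k/n), where ξ_{k,l} = exp(2πi·(k/n − l/(n−1))). -/

import Mathlib

open BigOperators

/-- The discrete Fourier transform of the first `m` values of a sequence `γ : ℕ → ℝ`: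
`z^{(m)}_k = (1/m) ∑_{j=0}^{m-1} γ_j · exp(2πi·jk/m)`. -/
noncomputable def dftN (m : ℕ) (γ : ℕ → ℝ) : Fin m → ℂ :=
  fun k => (1 / (m : ℂ)) * ∑ j : Fin m, (γ j : ℂ) *
    Complex.exp (2 * Real.pi * Complex.I * (j : ℕ) * (k : ℕ) / m)

/-- The root of unity `ξ_{k,l} = exp(2πi·(k/n − l/(n−1)))`. -/
noncomputable def xi (n k l : ℕ) : ℂ :=
  Complex.exp (2 * Real.pi * Complex.I * ((k : ℂ) / n - (l : ℂ) / (n - 1)))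

theorem dft_orth (m : ℕ) (hm : m ≠ 0) (a j : Fin m) :
    ∑ l : Fin m, (Complex.exp (2 * Real.pi * Complex.I * ((a : ℕ) : ℂ) * ((l : ℕ) : ℂ) / m) *
      Complex.exp (-(2 * Real.pi * Complex.I * ((j : ℕ) : ℂ) * ((l : ℕ) : ℂ) / m))) =
      if a = j then (m : ℂ) else 0 := by
  have hm' : (m : ℂ) ≠ 0 := by exact_mod_cast hm
  have hz := Complex.isPrimitiveRoot_exp m hm
  set z := Complex.exp (2 * Real.pi * Complex.I / m) with hzdef
  have hz0 : z ≠ 0 := Complex.exp_ne_zero _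
  have hterm : ∀ l : Fin m,
      (Complex.exp (2 * Real.pi * Complex.I * ((a : ℕ) : ℂ) * ((l : ℕ) : ℂ) / m) *
      Complex.exp (-(2 * Real.pi * Complex.I * ((j : ℕ) : ℂ) * ((l : ℕ) : ℂ) / m)))
      = (z ^ (a : ℕ) / z ^ (j : ℕ)) ^ (l : ℕ) := by
    intro l
    rw [hzdef, ← Complex.exp_nat_mul, ← Complex.exp_nat_mul, ← Complex.exp_sub,
      ← Complex.exp_nat_mul, ← Complex.exp_add]
    congr 1
    ring
  rw [Finset.sum_congr rfl (fun l _ => hterm l),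
    Fin.sum_univ_eq_sum_range (fun l => (z ^ (a : ℕ) / z ^ (j : ℕ)) ^ l) m]
  split_ifs with h
  · subst h
    rw [div_self (pow_ne_zero _ hz0)]
    simp
  · have hne : z ^ (a : ℕ) / z ^ (j : ℕ) ≠ 1 := by
      intro h1
      rw [div_eq_one_iff_eq (pow_ne_zero _ hz0)] at h1
      exact h (Fin.ext (hz.pow_inj a.2 j.2 h1))
    rw [geom_sum_eq hne, div_pow, ← pow_mul, ← pow_mul, mul_comm (a : ℕ), mul_comm (j : ℕ),
      pow_mul, pow_mul, hz.pow_eq_one]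
    simp

theorem dftN_inv (m : ℕ) (hm : m ≠ 0) (γ : ℕ → ℝ) (j : Fin m) :
    ∑ l : Fin m, dftN m γ l *
      Complex.exp (-(2 * Real.pi * Complex.I * ((j : ℕ) : ℂ) * ((l : ℕ) : ℂ) / m)) = (γ j : ℂ) := by
  have hm' : (m : ℂ) ≠ 0 := by exact_mod_cast hm
  simp only [dftN, mul_assoc (1 / (m : ℂ)), Finset.sum_mul]
  rw [← Finset.mul_sum, Finset.sum_comm]
  simp only [mul_assoc (Complex.ofReal _) (Complex.exp _) (Complex.exp _)]
  simp only [← Finset.mul_sum, dft_orth m hm]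
  simp
  field_simp

/-- Exact recursion relating the Fourier coefficients for `n` and `n−1` points:
`n·z^{(n)}_k = ∑_{l=0}^{n-2} z^{(n−1)}_l (∑_{j=0}^{n-2} ξ_{k,l}^j)
  + γ_{n−1}·exp(2πi·(n−1)k/n)`. -/
theorem dftN_recursion (n : ℕ) (hn : 2 ≤ n) (γ : ℕ → ℝ) (k : ℕ) (hk : k ≤ n - 1) :
    (n : ℂ) * dftN n γ ⟨k, by omega⟩ =
      (∑ l : Fin (n - 1), dftN (n - 1) γ l * ∑ j : Fin (n - 1), (xi n k l) ^ (j : ℕ)) +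
        (γ (n - 1) : ℂ) *
          Complex.exp (2 * Real.pi * Complex.I * ((n : ℂ) - 1) * (k : ℂ) / n) := by
  obtain ⟨m, rfl⟩ : ∃ m, n = m + 1 := ⟨n - 1, by omega⟩
  have hm : m ≠ 0 := by omega
  have hn' : ((m + 1 : ℕ) : ℂ) ≠ 0 := by exact_mod_cast Nat.succ_ne_zero m
  simp only [Nat.add_sub_cancel]
  have hL : ((m + 1 : ℕ) : ℂ) * dftN (m + 1) γ ⟨k, by omega⟩ =
      ∑ j : Fin (m + 1), (γ j : ℂ) *
        Complex.exp (2 * Real.pi * Complex.I * (j : ℕ) * (k : ℕ) / (m + 1 : ℕ)) := by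
    simp only [dftN]
    rw [← mul_assoc, mul_one_div_cancel hn', one_mul]
  rw [hL, Fin.sum_univ_castSucc]
  congr 1
  · simp only [Finset.mul_sum]
    rw [Finset.sum_comm]
    refine Finset.sum_congr rfl fun j _ => ?_
    simp only [Fin.val_castSucc]
    rw [← dftN_inv m hm γ j, Finset.sum_mul]
    refine Finset.sum_congr rfl fun l _ => ?_
    rw [mul_assoc, xi, ← Complex.exp_nat_mul, ← Complex.exp_add]
    congr 2
    push_cast
    rw [add_sub_cancel_right]
    ring
  · simp
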